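/- Let k be a field and let p, g, h ∈ k[x] be polynomials such that h − g has degree at least 1. Let n be a natural number with n > deg p, n > deg g, and n > deg h, and let a = α·xⁿ, b = β·xⁿ with α, β ∈ k nonzero. Then for all t, t₀, t₁, y ∈ k with t₀ + t₁ = 1 and (1−t)·t₀·t₁ ≠ 0, setting s = (1−t)·t₀·t₁ and w = C y + (C (1−t))·p + (C s)·b, the polynomial f = (C t₁ − (C s)·a)·(C t₀ + (C s)·a + g·w) + (C t₀ + (C s)·a)·(C t₁ − (C s)·a + h·w) ∈ k[x] has degree exactly 2n + deg(h − g) and leading coefficient s²·α·β·lc(h − g); in particular f is nonzero. -/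

import Mathlib

open Polynomial

/-- The divisor `𝒟¹ = Φ₁⁻¹(p⁻¹(D̄¹))`, obtained from `D¹` via the homotopy `Φ₁` between
the moving morphism `φ₁` and the identity, is quasi-finite over
`(Δ¹ ∖ V(t₀t₁)) × (𝔸¹∖1)_t` on the finite part `Y₀ ≠ 0`: the leading `x`-term of its
defining equation is `((1−t)t₀t₁)²·a·b·lf(h−g)`. -/
theorem stmt_5 {k : Type*} [Field k] (p g h : k[X]) (hgh : 1 ≤ (h - g).degree)
    (n : ℕ) (hnp : p.natDegree < n) (hng : g.natDegree < n) (hnh : h.natDegree < n)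
    (α β : k) (hα : α ≠ 0) (hβ : β ≠ 0)
    (a b : k[X]) (ha : a = C α * X ^ n) (hb : b = C β * X ^ n) :
    ∀ t t₀ t₁ y : k, t₀ + t₁ = 1 → (1 - t) * t₀ * t₁ ≠ 0 →
      let s := (1 - t) * t₀ * t₁
      let w := C y + C (1 - t) * p + C s * b
      let f := (C t₁ - C s * a) * (C t₀ + C s * a + g * w) +
               (C t₀ + C s * a) * (C t₁ - C s * a + h * w)
      f.natDegree = 2 * n + (h - g).natDegree ∧
      f.leadingCoeff = s ^ 2 * α * β * (h - g).leadingCoeff ∧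
      f ≠ 0 := by
  intro t t₀ t₁ y _ hs s w f
  have hs' : s ≠ 0 := hs
  have hd : 1 ≤ (h - g).natDegree := by
    have := natDegree_le_natDegree (p := (X : k[X])) (q := h - g) (by simpa using hgh)
    simpa using this
  have he0 : h - g ≠ 0 := by
    intro h0
    simp [h0] at hd
  have hc : s ^ 2 * α * β ≠ 0 := by simp [hs', hα, hβ]
  generalize he : h - g = e at *
  have hh : h = g + e := by rw [← he]; ring
  have hMdeg : (C (s ^ 2 * α * β) * (e * X ^ (2 * n))).natDegree = 2 * n + e.natDegree := by
    rw [natDegree_C_mul hc, natDegree_mul_X_pow _ he0, add_comm]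
  have hMlc : (C (s ^ 2 * α * β) * (e * X ^ (2 * n))).leadingCoeff
      = s ^ 2 * α * β * e.leadingCoeff := by
    rw [leadingCoeff_mul, leadingCoeff_C, leadingCoeff_mul_X_pow]
  have hM0 : C (s ^ 2 * α * β) * (e * X ^ (2 * n)) ≠ 0 :=
    mul_ne_zero (by simpa using hc) (mul_ne_zero he0 (pow_ne_zero _ X_ne_zero))
  have haN : a.natDegree ≤ n := by rw [ha]; exact natDegree_C_mul_X_pow_le _ _
  have hbN : b.natDegree ≤ n := by rw [hb]; exact natDegree_C_mul_X_pow_le _ _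
  have hCm : ∀ (c : k) (q : k[X]) (m : ℕ), q.natDegree ≤ m → (C c * q).natDegree ≤ m :=
    fun c q m hq => (natDegree_C_mul_le c q).trans hq
  have hC : ∀ (c : k) (m : ℕ), (C c : k[X]).natDegree ≤ m := fun c m => by simp
  have hA : (C t₀ + C s * a).natDegree ≤ n :=
    natDegree_add_le_of_degree_le (hC _ _) (hCm _ _ _ haN)
  have hB : (C t₁ - C s * a).natDegree ≤ n :=
    (natDegree_sub_le_of_le (hC _ n) (hCm _ _ n haN)).trans (by simp)
  have hu : (C y + C (1 - t) * p).natDegree ≤ n - 1 :=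
    natDegree_add_le_of_degree_le (hC _ _) (hCm _ _ _ (by omega))
  have hw : w.natDegree ≤ n :=
    natDegree_add_le_of_degree_le (hu.trans (by omega)) (hCm _ _ _ hbN)
  have hv : (C t₁ * g + C t₀ * h).natDegree ≤ n - 1 :=
    natDegree_add_le_of_degree_le (hCm _ _ _ (by omega)) (hCm _ _ _ (by omega))
  let R := C 2 * ((C t₀ + C s * a) * (C t₁ - C s * a)) + w * (C t₁ * g + C t₀ * h)
    + (C y + C (1 - t) * p) * (C s * a * e)
  have hf : f = C (s ^ 2 * α * β) * (e * X ^ (2 * n)) + R := by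
    simp only [f, R, w, hh, ha, hb, C_mul, C_pow, map_ofNat]
    ring
  have hR : R.natDegree ≤ 2 * n + e.natDegree - 1 := by
    refine natDegree_add_le_of_degree_le (natDegree_add_le_of_degree_le ?_ ?_) ?_
    · exact hCm _ _ _ ((natDegree_mul_le_of_le hA hB).trans (by omega))
    · exact (natDegree_mul_le_of_le hw hv).trans (by omega)
    · exact (natDegree_mul_le_of_le hu
        (natDegree_mul_le_of_le (hCm s a n haN) le_rfl)).trans (by omega)
  have hlt : R.degree < (C (s ^ 2 * α * β) * (e * X ^ (2 * n))).degree :=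
    degree_lt_degree (by rw [hMdeg]; omega)
  have h1 : f.natDegree = 2 * n + e.natDegree := by
    rw [hf, natDegree_add_eq_left_of_degree_lt hlt, hMdeg]
  have h2 : f.leadingCoeff = s ^ 2 * α * β * e.leadingCoeff := by
    rw [hf, leadingCoeff_add_of_degree_lt' hlt, hMlc]
  refine ⟨h1, h2, ?_⟩
  intro h0
  rw [h0, natDegree_zero] at h1
  omega
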